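/- arXiv:1212.1099 — 3 statements merged into one kernel-verified Lean document; each statement's English description precedes it below -/
import Mathlib

section
/- Let X be a nonempty set and let A be a commutative C*-algebra of bounded complex-valued functions on X, i.e. a subalgebra of the bounded functions X → ℂ (with pointwise operations) that is closed under complex conjugation and closed in the supremum norm. Assume A vanishes nowhere on X: for every x ∈ X there exists a ∈ A with a(x) ≠ 0. Define ι : X → Δ(A) by ι(x)(a) = a(x). Then ι(X) is a dense subset of the Gelfand spectrum Δ(A). -/
open BoundedContinuousFunction

lemma core_approx {X : Type*} [Nonempty X]
    [TopologicalSpace X] 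
    (A : NonUnitalStarSubalgebra ℂ (X →ᵇ ℂ)) (φ : WeakDual.characterSpace ℂ A)
    (I : Finset A) (ε : ℝ) (hε : 0 < ε) :
    ∃ x : X, ∀ a ∈ I, ‖(a : X →ᵇ ℂ) x - φ a‖ < ε := by
  by_contra! hcon
  obtain ⟨x₀⟩ := ‹Nonempty X›
  let F : X → ℝ := fun x => ∑ a ∈ I, ‖(a : X →ᵇ ℂ) x - φ a‖ ^ 2
  let M : ℝ := ∑ a ∈ I, (‖(a : X →ᵇ ℂ)‖ + ‖φ a‖) ^ 2
  have hF1 : ∀ x, ε ^ 2 ≤ F x := by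
    intro x
    obtain ⟨a, ha, h⟩ := hcon x
    calc ε ^ 2 ≤ ‖(a : X →ᵇ ℂ) x - φ a‖ ^ 2 := by gcongr
      _ ≤ F x := Finset.single_le_sum (f := fun a : A => ‖(a : X →ᵇ ℂ) x - φ a‖ ^ 2)
        (fun _ _ => by positivity) ha
  have hF2 : ∀ x, F x ≤ M := by
    intro x
    refine Finset.sum_le_sum fun a _ => ?_
    gcongr
    exact (norm_sub_le _ _).trans (by gcongr; exact norm_coe_le_norm _ x)
  have hM : 0 < M := lt_of_lt_of_le (by positivity) ((hF1 x₀).trans (hF2 x₀))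
  let T : A → A := fun b => b - (M⁻¹ : ℂ) • ∑ a ∈ I,
    (b * a * star a - (star (φ a)) • (b * a) - (φ a) • (b * star a)
      + (φ a * star (φ a)) • b)
  have hTφ : ∀ b, φ (T b) = φ b := by
    intro b
    simp only [T, map_sub, map_smul, map_sum, map_add, map_mul, smul_eq_mul]
    rw [Finset.sum_eq_zero]
    · simp
    · intro a _
      ring
  have hTx : ∀ (b : A) (x : X), (T b : X →ᵇ ℂ) x = ((1 - F x / M : ℝ) : ℂ) * (b : X →ᵇ ℂ) x := by
    intro b x
    have h1 : ∀ a : A, ((‖(a : X →ᵇ ℂ) x - φ a‖ ^ 2 : ℝ) : ℂ)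
        = ((a : X →ᵇ ℂ) x - φ a) * (star ((a : X →ᵇ ℂ) x) - star (φ a)) := by
      intro a
      rw [← star_sub]
      push_cast
      exact (Complex.mul_conj' _).symm
    have h2 : ((F x : ℝ) : ℂ) = ∑ a ∈ I,
        ((a : X →ᵇ ℂ) x - φ a) * (star ((a : X →ᵇ ℂ) x) - star (φ a)) := by
      simp only [F, Complex.ofReal_sum, h1]
    have h3 : (T b : X →ᵇ ℂ) x = (b : X →ᵇ ℂ) x - (M⁻¹ : ℂ) * ∑ a ∈ I,
      ((b : X →ᵇ ℂ) x * (a : X →ᵇ ℂ) x * star ((a : X →ᵇ ℂ) x)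
        - (star (φ a)) * ((b : X →ᵇ ℂ) x * (a : X →ᵇ ℂ) x)
        - (φ a) * ((b : X →ᵇ ℂ) x * star ((a : X →ᵇ ℂ) x))
        + (φ a * star (φ a)) * (b : X →ᵇ ℂ) x) := by
      simp [T, BoundedContinuousFunction.sum_apply]
    rw [h3]
    push_cast
    rw [h2, div_eq_inv_mul, sub_mul, one_mul, mul_assoc, Finset.sum_mul]
    congr 2
    refine Finset.sum_congr rfl fun a _ => ?_
    ring
  set r : ℝ := 1 - ε ^ 2 / M with hr
  have hr0 : 0 ≤ r := by
    rw [hr, sub_nonneg, div_le_one hM]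
    exact (hF1 x₀).trans (hF2 x₀)
  have hr1 : r < 1 := by
    have : 0 < ε ^ 2 / M := by positivity
    linarith
  have hTn : ∀ b, ‖T b‖ ≤ r * ‖b‖ := by
    intro b
    change ‖(T b : X →ᵇ ℂ)‖ ≤ r * ‖(b : X →ᵇ ℂ)‖
    refine (BoundedContinuousFunction.norm_le (by positivity)).2 fun x => ?_
    rw [hTx, norm_mul, Complex.norm_real, Real.norm_eq_abs, abs_of_nonneg]
    · have := hF1 x
      refine mul_le_mul ?_ (norm_coe_le_norm _ x) (norm_nonneg _) hr0
      rw [hr]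
      gcongr
    · rw [sub_nonneg, div_le_one hM]
      exact hF2 x
  have hit : ∀ (n : ℕ) (b : A), φ (T^[n] b) = φ b ∧ ‖T^[n] b‖ ≤ r ^ n * ‖b‖ := by
    intro n b
    induction n with
    | zero => simp
    | succ n ih =>
      rw [Function.iterate_succ_apply', hTφ]
      refine ⟨ih.1, (hTn _).trans ?_⟩
      rw [pow_succ', mul_assoc]
      gcongr
      exact ih.2
  apply φ.2.1
  refine ContinuousLinearMap.ext fun b => ?_
  change φ b = 0
  have hz : Filter.Tendsto (fun n => T^[n] b) Filter.atTop (nhds 0) := by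
    refine squeeze_zero_norm (fun n => (hit n b).2) ?_
    simpa using (tendsto_pow_atTop_nhds_zero_of_lt_one hr0 hr1).mul_const ‖b‖
  have h1 := ((map_continuous φ).tendsto 0).comp hz
  have h2 : (φ ∘ fun n => T^[n] b) = fun _ => φ b := funext fun n => (hit n b).1
  rw [h2, map_zero] at h1
  exact tendsto_nhds_unique tendsto_const_nhds h1

/-- Let `X` be a nonempty set (modeled with the discrete topology, so that
`X →ᵇ ℂ` is precisely the C*-algebra of bounded complex-valued functions on `X` with the
supremum norm).  Let `A` be a (not necessarily unital) subalgebra of the bounded functions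
`X → ℂ` that is closed under complex conjugation (a `NonUnitalStarSubalgebra`) and closed in
the supremum norm.  Assume `A` vanishes nowhere on `X`.  Define `ι : X → Δ(A)` by
`ι(x)(a) = a(x)`.  Then `ι(X)` — i.e. the set of characters that are given by evaluation at
some point of `X` — is dense in the Gelfand spectrum `Δ(A)` (the character space of `A` with
its Gelfand = weak-* topology). -/
theorem evaluation_characters_dense {X : Type*} [Nonempty X]
    [TopologicalSpace X] [DiscreteTopology X]
    (A : NonUnitalStarSubalgebra ℂ (X →ᵇ ℂ))
    (hA : IsClosed (A : Set (X →ᵇ ℂ)))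
    (hnv : ∀ x : X, ∃ a ∈ A, a x ≠ 0) :
    Dense {φ : WeakDual.characterSpace ℂ A | ∃ x : X, ∀ a : A, (φ : WeakDual ℂ A) a = (a : X →ᵇ ℂ) x} := by
  have hind : Topology.IsInducing
      (fun (φ : WeakDual.characterSpace ℂ A) (a : A) => (φ : WeakDual ℂ A) a) :=
    (Topology.IsInducing.mk rfl : Topology.IsInducing
      (fun (φ : WeakDual ℂ A) (a : A) => φ a)).comp Topology.IsInducing.subtypeVal
  intro φ
  rw [mem_closure_iff_nhds]
  intro U hU
  rw [hind.nhds_eq_comap, Filter.mem_comap] at hU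
  obtain ⟨V, hV, hVU⟩ := hU
  rw [nhds_pi, Filter.mem_pi] at hV
  obtain ⟨I, hI, t, ht, htV⟩ := hV
  have hε : ∃ ε > 0, ∀ a ∈ I, Metric.ball (φ a) ε ⊆ t a := by
    have : ∀ a, ∃ ε > 0, Metric.ball (φ a) ε ⊆ t a := fun a => Metric.mem_nhds_iff.1 (ht a)
    choose e he hte using this
    rcases I.eq_empty_or_nonempty with rfl | hne
    · exact ⟨1, one_pos, by simp⟩
    · obtain ⟨a₀, _, hmin⟩ := Set.exists_min_image I e hI hne
      exact ⟨e a₀, he a₀, fun a ha => (Metric.ball_subset_ball (hmin a ha)).trans (hte a)⟩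
  obtain ⟨ε, hε, hball⟩ := hε
  obtain ⟨x, hx⟩ := core_approx A φ hI.toFinset ε hε
  let L : A →L[ℂ] ℂ :=
    { toFun := fun a => (a : X →ᵇ ℂ) x
      map_add' := fun _ _ => rfl
      map_smul' := fun _ _ => rfl
      cont := (BoundedContinuousFunction.evalCLM ℂ x).continuous.comp continuous_subtype_val }
  obtain ⟨a₀, ha₀, hne⟩ := hnv x
  let ψ : WeakDual.characterSpace ℂ A :=
    ⟨(L : WeakDual ℂ A), fun h => hne (DFunLike.congr_fun h (⟨a₀, ha₀⟩ : A)), fun _ _ => rfl⟩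
  refine ⟨ψ, hVU (htV fun a ha => hball a ha ?_), x, fun a => rfl⟩
  rw [Metric.mem_ball, dist_eq_norm]
  exact hx a (hI.mem_toFinset.2 ha)
end

section
/- Let μ be a nonnegative measure on σ(B), the σ-algebra on X generated by B, such that every f ∈ B is μ-integrable. Then there exists a unique nonnegative Radon measure μ̂ on the Borel σ-algebra of Δ such that ∫_X f dμ = ∫_Δ f̂ dμ̂ for all f ∈ B. -/
open MeasureTheory Filter Topology BoundedContinuousFunction
open scoped ZeroAtInfty ENNReal

/-- The complexification of a bounded real-valued function: we regard a bounded real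
function on `X` as a bounded complex function. (`X` carries the discrete topology, so
`X →ᵇ ℝ` is exactly the space of bounded real-valued functions on `X`.) -/
noncomputable def cplx {X : Type*} [TopologicalSpace X] (f : X →ᵇ ℝ) : X →ᵇ ℂ :=
  BoundedContinuousFunction.comp Complex.ofReal Complex.isometry_ofReal.lipschitz f

/-- `A(B)`: the closure, in the supremum norm, of the complexification `B + iB` of a
set `B` of bounded real-valued functions, inside the C*-algebra of all bounded
complex-valued functions on `X`. -/
noncomputable def AofB {X : Type*} [TopologicalSpace X] (B : Set (X →ᵇ ℝ)) : Set (X →ᵇ ℂ) :=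
  closure {a : X →ᵇ ℂ | ∃ f ∈ B, ∃ g ∈ B, a = cplx f + Complex.I • cplx g}
/-- Uniform approximation. -/
theorem aux_approx {X : Type*} [TopologicalSpace X]
    (B : Set (X →ᵇ ℝ)) {Δ : Type*} [TopologicalSpace Δ]
    (ι : X → Δ) (G : (X →ᵇ ℂ) → C₀(Δ, ℂ))
    (hGeval : ∀ a ∈ AofB B, ∀ x : X, G a (ι x) = a x)
    (hGsurj : ∀ h : C₀(Δ, ℂ), ∃ a ∈ AofB B, G a = h)
    (h : CompactlySupportedContinuousMap Δ ℝ) (ε : ℝ) (hε : 0 < ε) :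
    ∃ f ∈ B, ∀ x, |f x - h (ι x)| < ε := by
  have hc : HasCompactSupport (fun d => ((h d : ℝ) : ℂ)) :=
    h.hasCompactSupport.comp_left (g := Complex.ofReal) (by simp)
  let hC : CompactlySupportedContinuousMap Δ ℂ :=
    ⟨⟨fun d => ((h d : ℝ) : ℂ), Complex.continuous_ofReal.comp (map_continuous h)⟩, hc⟩
  obtain ⟨a, ha, hGa⟩ := hGsurj ⟨⟨fun d => ((h d : ℝ) : ℂ),
    Complex.continuous_ofReal.comp (map_continuous h)⟩, hc.is_zero_at_infty⟩
  obtain ⟨b, ⟨f, hf, g, hg, rfl⟩, hb⟩ := Metric.mem_closure_iff.1 ha ε hε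
  refine ⟨f, hf, fun x => ?_⟩
  have h1 : a x = ((h (ι x) : ℝ) : ℂ) := by
    rw [← hGeval a ha x, hGa]; rfl
  have h2 := (BoundedContinuousFunction.dist_coe_le_dist (f := a)
    (g := cplx f + Complex.I • cplx g) x).trans_lt hb
  rw [dist_comm, dist_eq_norm, h1] at h2
  refine lt_of_le_of_lt ?_ h2
  have h3 := Complex.abs_re_le_norm
    ((cplx f + Complex.I • cplx g) x - ((h (ι x) : ℝ) : ℂ))
  simpa [cplx] using h3

theorem aux_dom {X : Type*} [TopologicalSpace X]
    (B : Set (X →ᵇ ℝ)) (hBsmul : ∀ (c : ℝ), ∀ f ∈ B, c • f ∈ B)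
    (hBmax : ∀ f ∈ B, ∀ g ∈ B, ∃ h ∈ B, ∀ x, h x = max (f x) (g x))
    {Δ : Type*} [TopologicalSpace Δ] [LocallyCompactSpace Δ] [T2Space Δ]
    (ι : X → Δ) (G : (X →ᵇ ℂ) → C₀(Δ, ℂ))
    (hGeval : ∀ a ∈ AofB B, ∀ x : X, G a (ι x) = a x)
    (hGsurj : ∀ h : C₀(Δ, ℂ), ∃ a ∈ AofB B, G a = h)
    (h : CompactlySupportedContinuousMap Δ ℝ) :
    ∃ g ∈ B, ∀ x, |h (ι x)| ≤ g x := by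
  obtain ⟨k, hk1, -, hk2, hk3⟩ := exists_continuous_one_zero_of_isCompact
    h.hasCompactSupport.isCompact isClosed_empty (Set.disjoint_empty _)
  obtain ⟨f, hf, hfk⟩ := aux_approx B ι G hGeval hGsurj ⟨k, hk2⟩ (1/2) (by norm_num)
  obtain ⟨M, hM⟩ := h.hasCompactSupport.exists_bound_of_continuous (map_continuous h)
  obtain ⟨g, hg, hgx⟩ := hBmax _ (hBsmul (2 * |M|) f hf) _ (hBsmul (-(2 * |M|)) f hf)
  refine ⟨g, hg, fun x => ?_⟩
  have hg' : g x = 2 * |M| * |f x| := by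
    rw [hgx]
    simp only [BoundedContinuousFunction.coe_smul, smul_eq_mul, neg_mul]
    rw [← abs_eq_max_neg, abs_mul, abs_of_nonneg (a := 2 * |M|) (by positivity)]
  rw [hg']
  by_cases hx : ι x ∈ tsupport h
  · have h1 : k (ι x) = 1 := hk1 hx
    have h2 := hfk x
    have h3 : (1:ℝ)/2 ≤ |f x| := by
      change |f x - k (ι x)| < _ at h2
      rw [h1] at h2
      have := (abs_lt.1 h2).1
      exact le_trans (by linarith) (le_abs_self _)
    have h4 := hM (ι x)
    rw [Real.norm_eq_abs] at h4
    have h5 := le_abs_self M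
    nlinarith [abs_nonneg M]
  · rw [image_eq_zero_of_notMem_tsupport hx, abs_zero]; positivity

theorem aux_int {X : Type*} [TopologicalSpace X]
    (B : Set (X →ᵇ ℝ)) (hBsmul : ∀ (c : ℝ), ∀ f ∈ B, c • f ∈ B)
    (hBmax : ∀ f ∈ B, ∀ g ∈ B, ∃ h ∈ B, ∀ x, h x = max (f x) (g x))
    (hBmin : ∀ f ∈ B, ∀ g ∈ B, ∃ h ∈ B, ∀ x, h x = min (f x) (g x))
    {Δ : Type*} [TopologicalSpace Δ] [LocallyCompactSpace Δ] [T2Space Δ]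
    (ι : X → Δ) (G : (X →ᵇ ℂ) → C₀(Δ, ℂ))
    (hGeval : ∀ a ∈ AofB B, ∀ x : X, G a (ι x) = a x)
    (hGsurj : ∀ h : C₀(Δ, ℂ), ∃ a ∈ AofB B, G a = h)
    (h : CompactlySupportedContinuousMap Δ ℝ) :
    ∃ g ∈ B, ∃ F : ℕ → (X →ᵇ ℝ), (∀ n, F n ∈ B) ∧ (∀ x, |h (ι x)| ≤ g x) ∧
      (∀ n x, |F n x| ≤ g x) ∧ ∀ n x, |F n x - h (ι x)| ≤ 1 / ((n : ℝ) + 1) := by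
  obtain ⟨g, hg, hgx⟩ := aux_dom B hBsmul hBmax ι G hGeval hGsurj h
  have H : ∀ n : ℕ, ∃ f ∈ B, (∀ x, |f x| ≤ g x) ∧
      ∀ x, |f x - h (ι x)| ≤ 1 / ((n : ℝ) + 1) := by
    intro n
    obtain ⟨f, hf, hfx⟩ := aux_approx B ι G hGeval hGsurj h (1 / ((n : ℝ) + 1)) (by positivity)
    obtain ⟨f1, hf1, hf1x⟩ := hBmin _ hf _ hg
    obtain ⟨f2, hf2, hf2x⟩ := hBmax _ hf1 _ (hBsmul (-1) _ hg)
    refine ⟨f2, hf2, fun x => ?_, fun x => ?_⟩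
    · rw [hf2x, hf1x]
      have := hgx x
      have h0 := (abs_nonneg _).trans this
      simp only [BoundedContinuousFunction.coe_smul, smul_eq_mul, neg_mul, one_mul]
      rw [abs_le]
      exact ⟨le_max_right _ _, max_le (min_le_right _ _) (by linarith)⟩
    · rw [hf2x, hf1x]
      have h1 := abs_le.1 (hgx x)
      have h2 := abs_le.1 (hfx x).le
      have h3 : (0:ℝ) < 1 / ((n : ℝ) + 1) := by positivity
      simp only [BoundedContinuousFunction.coe_smul, smul_eq_mul, neg_mul, one_mul]
      rw [abs_le]
      constructor
      · have : h (ι x) - 1 / ((n : ℝ) + 1) ≤ min (f x) (g x) :=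
          le_min (by linarith) (by linarith)
        linarith [le_max_left (min (f x) (g x)) (-(g x))]
      · have : max (min (f x) (g x)) (-(g x)) ≤ h (ι x) + 1 / ((n : ℝ) + 1) :=
          max_le ((min_le_left _ _).trans (by linarith)) (by linarith)
        linarith
  choose F hF hF1 hF2 using H
  exact ⟨g, hg, F, hF, hgx, hF1, hF2⟩

theorem aux_tendsto {u : ℕ → ℝ} {a : ℝ} (h : ∀ n : ℕ, |u n - a| ≤ 1 / ((n : ℝ) + 1)) :
    Tendsto u atTop (𝓝 a) := by
  rw [tendsto_iff_dist_tendsto_zero]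
  exact squeeze_zero (fun _ => dist_nonneg) h tendsto_one_div_add_atTop_nhds_zero_nat

theorem aux_trunc (c : ℝ) (hc : 0 ≤ c) (n : ℕ) :
    |max (c - 1 / ((n : ℝ) + 1)) 0 - c| ≤ 1 / ((n : ℝ) + 1) := by
  have h3 : (0:ℝ) < 1 / ((n : ℝ) + 1) := by positivity
  rcases max_cases (c - 1 / ((n : ℝ) + 1)) 0 with ⟨h, h'⟩ | ⟨h, h'⟩ <;> rw [h, abs_le] <;>
    constructor <;> linarith

theorem aux_lint {Y : Type*} [MeasurableSpace Y] (ν : Measure Y) (u : Y → ℝ)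
    (hu : AEMeasurable u ν) (hu0 : ∀ y, 0 ≤ u y) :
    Tendsto (fun n : ℕ => ∫⁻ y, ENNReal.ofReal (max (u y - 1 / ((n : ℝ) + 1)) 0) ∂ν) atTop
      (𝓝 (∫⁻ y, ENNReal.ofReal (u y) ∂ν)) := by
  refine lintegral_tendsto_of_tendsto_of_monotone (fun n => ?_) (ae_of_all _ fun y => ?_)
    (ae_of_all _ fun y => ?_)
  · exact ((hu.sub_const _).max aemeasurable_const).ennreal_ofReal
  · intro m n hmn
    refine ENNReal.ofReal_le_ofReal (max_le_max_right _ (sub_le_sub_left ?_ _))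
    exact Nat.one_div_le_one_div hmn
  · exact (ENNReal.continuous_ofReal.tendsto _).comp (aux_tendsto (aux_trunc _ (hu0 y)))

/-- Let `μ` be a nonnegative measure on `σ(B)` (the σ-algebra on `X`
generated by the functions of `B`) such that every `f ∈ B` is `μ`-integrable.  Then there
exists a unique nonnegative Radon measure `ν = μ̂` on the Borel σ-algebra of `Δ` such that
every `f̂` (`f ∈ B`) is `ν`-integrable and `∫_X f dμ = ∫_Δ f̂ dν` for all `f ∈ B`.  (Radon:
finite on compacts, outer regular, inner regular by compacts on open sets, i.e.
`Measure.Regular`.) -/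
theorem exists_unique_transferred_measure {X : Type*} [Nonempty X] [TopologicalSpace X] [DiscreteTopology X]
    (B : Set (X →ᵇ ℝ))
    (hBadd : ∀ f ∈ B, ∀ g ∈ B, f + g ∈ B)
    (hBsmul : ∀ (c : ℝ), ∀ f ∈ B, c • f ∈ B)
    (hBmax : ∀ f ∈ B, ∀ g ∈ B, ∃ h ∈ B, ∀ x, h x = max (f x) (g x))
    (hBmin : ∀ f ∈ B, ∀ g ∈ B, ∃ h ∈ B, ∀ x, h x = min (f x) (g x))
    (hBmul : ∀ f ∈ B, ∀ g ∈ B, f * g ∈ B)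
    (hBstone : ∀ f ∈ B, ∃ h ∈ B, ∀ x, h x = min (f x) 1)
    (hBnv : ∀ x : X, ∃ f ∈ B, f x ≠ 0)
    {Δ : Type*} [TopologicalSpace Δ] [LocallyCompactSpace Δ] [T2Space Δ]
    [MeasurableSpace Δ] [BorelSpace Δ]
    (ι : X → Δ) (hι : DenseRange ι)
    (G : (X →ᵇ ℂ) → C₀(Δ, ℂ))
    (hGeval : ∀ a ∈ AofB B, ∀ x : X, G a (ι x) = a x)
    (hGsurj : ∀ h : C₀(Δ, ℂ), ∃ a ∈ AofB B, G a = h)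
    {mX : MeasurableSpace X}
    (hmX : mX = ⨆ f ∈ B, MeasurableSpace.comap (⇑f : X → ℝ) inferInstance)
    (μ : Measure X) (hμ : ∀ f ∈ B, Integrable (⇑f) μ)
:
    ∃! ν : Measure Δ, ν.Regular ∧
      ∀ f ∈ B, Integrable (fun φ => ((G (cplx f)) φ).re) ν ∧
        ∫ x, f x ∂μ = ∫ φ, ((G (cplx f)) φ).re ∂ν := by
  classical
  obtain ⟨x0⟩ := ‹Nonempty X›
  have h0B : (0 : X →ᵇ ℝ) ∈ B := by
    obtain ⟨f, hf, -⟩ := hBnv x0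
    simpa using hBsmul 0 f hf
  have hmem : ∀ f ∈ B, cplx f ∈ AofB B := fun f hf =>
    subset_closure ⟨f, hf, 0, h0B, by ext x; simp [cplx]⟩
  have hev : ∀ f ∈ B, ∀ x, ((G (cplx f)) (ι x)).re = f x := by
    intro f hf x
    rw [hGeval _ (hmem f hf) x]; simp [cplx]
  have hcont : ∀ f : X →ᵇ ℝ, Continuous (fun φ => ((G (cplx f)) φ).re) := fun f =>
    Complex.continuous_re.comp (map_continuous (G (cplx f)))
  have hsub : ∀ f ∈ B, ∀ g ∈ B, f - g ∈ B := by
    intro f hf g hg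
    have := hBadd f hf _ (hBsmul (-1) g hg)
    have e : f - g = f + (-1 : ℝ) • g := by ext x; simp [sub_eq_add_neg]
    rwa [e]
  have key := aux_int B hBsmul hBmax hBmin ι G hGeval hGsurj
  -- integrability of compactly supported functions
  have hint : ∀ h : CompactlySupportedContinuousMap Δ ℝ, Integrable (fun x => h (ι x)) μ := by
    intro h
    obtain ⟨g, hg, F, hF, hgh, hFg, hFh⟩ := key h
    refine (hμ g hg).mono' ?_ (ae_of_all _ hgh)
    exact aestronglyMeasurable_of_tendsto_ae atTop (fun n => (hμ _ (hF n)).1)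
      (ae_of_all _ fun x => aux_tendsto fun n => hFh n x)
  -- uniqueness core
  have huniq : ∀ ν : Measure Δ,
      (∀ f ∈ B, Integrable (fun φ => ((G (cplx f)) φ).re) ν ∧
        ∫ x, f x ∂μ = ∫ φ, ((G (cplx f)) φ).re ∂ν) →
      ∀ h : CompactlySupportedContinuousMap Δ ℝ, ∫ φ, h φ ∂ν = ∫ x, h (ι x) ∂μ := by
    intro ν hν h
    obtain ⟨g, hg, F, hF, hgh, hFg, hFh⟩ := key h
    have t1 : Tendsto (fun n => ∫ x, F n x ∂μ) atTop (𝓝 (∫ x, h (ι x) ∂μ)) :=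
      tendsto_integral_of_dominated_convergence (fun x => g x) (fun n => (hμ _ (hF n)).1)
        (hμ g hg) (fun n => ae_of_all _ (hFg n))
        (ae_of_all _ fun x => aux_tendsto fun n => hFh n x)
    have t2 : Tendsto (fun n => ∫ φ, ((G (cplx (F n))) φ).re ∂ν) atTop (𝓝 (∫ φ, h φ ∂ν)) := by
      refine tendsto_integral_of_dominated_convergence (fun φ => ((G (cplx g)) φ).re)
        (fun n => (hν _ (hF n)).1.1) (hν g hg).1 (fun n => ae_of_all _ fun φ => ?_)
        (ae_of_all _ fun φ => aux_tendsto fun n => ?_)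
      · refine hι.induction_on
          (p := fun φ => ‖((G (cplx (F n))) φ).re‖ ≤ ((G (cplx g)) φ).re) φ
          (isClosed_le (hcont _).norm (hcont _)) fun x => ?_
        rw [hev _ (hF n), hev _ hg]
        exact hFg n x
      · refine hι.induction_on
          (p := fun φ => |((G (cplx (F n))) φ).re - h φ| ≤ 1 / ((n : ℝ) + 1)) φ
          (isClosed_le ((hcont _).sub (map_continuous h)).abs continuous_const) fun x => ?_
        rw [hev _ (hF n)]
        exact hFh n x
    refine tendsto_nhds_unique t2 ?_
    convert t1 using 2 with n
    exact (hν _ (hF n)).2.symm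
  -- the functional
  let L : CompactlySupportedContinuousMap Δ ℝ →ₗ[ℝ] ℝ :=
    { toFun := fun h => ∫ x, h (ι x) ∂μ
      map_add' := fun h k => integral_add (hint h) (hint k)
      map_smul' := fun c h => integral_const_mul c _ }
  let Λ : CompactlySupportedContinuousMap Δ ℝ →ₚ[ℝ] ℝ :=
    PositiveLinearMap.mk₀ L (fun h hh => integral_nonneg fun x => hh (ι x))
  have hΛ : ∀ h : CompactlySupportedContinuousMap Δ ℝ, ∫ φ, h φ ∂(RealRMK.rieszMeasure Λ) = ∫ x, h (ι x) ∂μ := fun h =>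
    RealRMK.integral_rieszMeasure Λ h
  have hreg : (RealRMK.rieszMeasure Λ).Regular := RealRMK.regular_rieszMeasure Λ
  generalize RealRMK.rieszMeasure Λ = ν at hΛ hreg
  -- positive elements
  have hpos : ∀ f ∈ B, (∀ x, 0 ≤ f x) → Integrable (fun φ => ((G (cplx f)) φ).re) ν ∧
        ∫ x, f x ∂μ = ∫ φ, ((G (cplx f)) φ).re ∂ν := by
    intro f hf hf0
    have hF0 : ∀ φ, 0 ≤ ((G (cplx f)) φ).re := by
      intro φ
      refine hι.induction_on (p := fun φ => 0 ≤ ((G (cplx f)) φ).re) φ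
        (isClosed_le continuous_const (hcont _)) fun x => ?_
      rw [hev _ hf]; exact hf0 x
    have hcs : ∀ n : ℕ, HasCompactSupport
        (fun φ => max (((G (cplx f)) φ).re - 1 / ((n : ℝ) + 1)) 0) := by
      intro n
      have hn : (0:ℝ) < 1 / ((n : ℝ) + 1) := by positivity
      have hz := (G (cplx f)).zero_at_infty'
      have hz' := (Metric.tendsto_nhds.1 hz) _ hn
      obtain ⟨K, hK, hKs⟩ := mem_cocompact.1 hz'
      refine HasCompactSupport.intro hK fun φ hφ => ?_
      have h1 := hKs hφ
      simp only [Set.mem_setOf_eq, dist_zero_right] at h1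
      have h2 := (Complex.re_le_norm ((G (cplx f)) φ)).trans_lt h1
      exact max_eq_right (by linarith)
    have heq : ∀ n : ℕ,
        ∫⁻ φ, ENNReal.ofReal (max (((G (cplx f)) φ).re - 1 / ((n : ℝ) + 1)) 0) ∂ν =
        ∫⁻ x, ENNReal.ofReal (max (f x - 1 / ((n : ℝ) + 1)) 0) ∂μ := by
      intro n
      let h : CompactlySupportedContinuousMap Δ ℝ :=
        ⟨⟨_, ((hcont f).sub continuous_const).max continuous_const⟩, hcs n⟩
      have hi : Integrable h ν := (map_continuous h).integrable_of_hasCompactSupport (hcs n)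
      have e1 := ofReal_integral_eq_lintegral_ofReal hi
        (ae_of_all _ fun φ => le_max_right _ _)
      have e2 := ofReal_integral_eq_lintegral_ofReal (hint h)
        (ae_of_all _ fun φ => le_max_right _ _)
      have e3 := e1.symm.trans ((congrArg ENNReal.ofReal (hΛ h)).trans e2)
      have e4 : ∀ x, h (ι x) = max (f x - 1 / ((n : ℝ) + 1)) 0 := by
        intro x
        rw [← hev f hf x]; rfl
      simp only [e4] at e3
      exact e3
    have t1 := aux_lint ν _ (hcont f).aemeasurable hF0
    have t2 := aux_lint μ _ (hμ f hf).1.aemeasurable hf0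
    simp only [heq] at t1
    have E := tendsto_nhds_unique t1 t2
    have hfin : ∫⁻ x, ENNReal.ofReal (f x) ∂μ ≠ ⊤ := by
      rw [← ofReal_integral_eq_lintegral_ofReal (hμ f hf) (ae_of_all _ hf0)]
      exact ENNReal.ofReal_ne_top
    refine ⟨⟨(hcont f).aestronglyMeasurable, ?_⟩, ?_⟩
    · rw [hasFiniteIntegral_iff_ofReal (ae_of_all _ hF0), E]
      exact lt_top_iff_ne_top.2 hfin
    · rw [integral_eq_lintegral_of_nonneg_ae (ae_of_all _ hf0) (hμ f hf).1,
        integral_eq_lintegral_of_nonneg_ae (ae_of_all _ hF0) (hcont f).aestronglyMeasurable, E]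
  refine ⟨ν, ⟨hreg, fun f hf => ?_⟩, ?_⟩
  · obtain ⟨p, hp, hpx⟩ := hBmax f hf 0 h0B
    have hp0 : ∀ x, 0 ≤ p x := fun x => by rw [hpx]; exact le_max_right _ _
    have hq := hsub p hp f hf
    have hq0 : ∀ x, 0 ≤ (p - f) x := fun x => by
      rw [BoundedContinuousFunction.sub_apply, hpx]; exact sub_nonneg.2 (le_max_left _ _)
    obtain ⟨i1, j1⟩ := hpos p hp hp0
    obtain ⟨i2, j2⟩ := hpos _ hq hq0
    have hd : (fun φ => ((G (cplx f)) φ).re) =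
        fun φ => ((G (cplx p)) φ).re - ((G (cplx (p - f))) φ).re := by
      refine hι.equalizer (hcont f) ((hcont p).sub (hcont _)) ?_
      funext x
      simp only [Function.comp]
      rw [hev f hf, hev p hp, hev _ hq]
      simp
    rw [hd]
    refine ⟨i1.sub i2, ?_⟩
    rw [integral_sub i1 i2, ← j1, ← j2, ← integral_sub (hμ p hp) (hμ _ hq)]
    simp
  · rintro ν' ⟨hreg', hν'⟩
    haveI := hreg
    haveI := hreg'
    refine Measure.ext_of_integral_eq_on_compactlySupported fun h => ?_
    rw [huniq ν' hν' h, hΛ h]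
end

section
/- Let (E, F) be a resistance form on a countable set V*. Then the effective resistance R(x,y) = sup{(u(x) − u(y))² / E(u,u) : u ∈ F, E(u,u) > 0} is a metric on V*: R(x,y) ≥ 0 with R(x,y) = 0 if and only if x = y, R(x,y) = R(y,x), and R(x,z) ≤ R(x,y) + R(y,z) for all x, y, z ∈ V*. -/
open MeasureTheory Filter Topology

/-- A resistance form `(E, F)` on a set `V` in the sense of Kigami:
(RF1) `F` is a linear subspace of the real-valued functions on `V` containing the
constants, and `E` is a nonnegative definite symmetric bilinear form on `F` with
`E(u,u) = 0` iff `u` is constant; (RF2) the quotient of `F` by the constants is complete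
in the seminorm `E(u,u)^{1/2}`; (RF3) finite sets admit arbitrary extensions; (RF4) the
effective resistance between any two points is finite; (RF5) the Markov property. -/
structure ResistanceForm (V : Type*) where
  F : Set (V → ℝ)
  E : (V → ℝ) → (V → ℝ) → ℝ
  const_mem : ∀ c : ℝ, (fun _ => c) ∈ F
  add_mem : ∀ u ∈ F, ∀ v ∈ F, u + v ∈ F
  smul_mem : ∀ (c : ℝ), ∀ u ∈ F, c • u ∈ F
  symm : ∀ u v, E u v = E v u
  add_left : ∀ u ∈ F, ∀ v ∈ F, ∀ w ∈ F, E (u + v) w = E u w + E v w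
  smul_left : ∀ (c : ℝ), ∀ u ∈ F, ∀ v ∈ F, E (c • u) v = c * E u v
  nonneg : ∀ u ∈ F, 0 ≤ E u u
  zero_iff : ∀ u ∈ F, (E u u = 0 ↔ ∃ c : ℝ, ∀ x, u x = c)
  complete : ∀ u : ℕ → (V → ℝ), (∀ n, u n ∈ F) →
    (∀ ε > 0, ∃ N, ∀ n ≥ N, ∀ m ≥ N, E (u n - u m) (u n - u m) < ε) →
    ∃ v ∈ F, Tendsto (fun n => E (u n - v) (u n - v)) atTop (𝓝 0)
  finite_ext : ∀ (V' : Finset V) (v : V → ℝ), ∃ u ∈ F, ∀ x ∈ V', u x = v x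
  resistance_bdd : ∀ x y : V,
    BddAbove {r : ℝ | ∃ u ∈ F, 0 < E u u ∧ r = (u x - u y) ^ 2 / E u u}
  markov : ∀ u ∈ F, (fun x => min (max (u x) 0) 1) ∈ F ∧
    E (fun x => min (max (u x) 0) 1) (fun x => min (max (u x) 0) 1) ≤ E u u

namespace ResistanceForm

theorem expand {V : Type*} (RF : ResistanceForm V) {u v : V → ℝ} (hu : u ∈ RF.F)
    (hv : v ∈ RF.F) (k : ℝ) :
    RF.E (u + k • v) (u + k • v) = RF.E u u + 2 * k * RF.E u v + k ^ 2 * RF.E v v := by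
  have hk := RF.smul_mem k v hv
  have hs := RF.add_mem u hu _ hk
  rw [RF.add_left u hu _ hk _ hs, RF.smul_left k v hv _ hs, RF.symm u, RF.symm v,
    RF.add_left u hu _ hk _ hu, RF.smul_left k v hv _ hu,
    RF.add_left u hu _ hk _ hv, RF.smul_left k v hv _ hv, RF.symm v u]
  ring

theorem const_energy {V : Type*} (RF : ResistanceForm V) {u : V → ℝ} (hu : u ∈ RF.F) (c : ℝ) :
    RF.E (u + fun _ => c) (u + fun _ => c) = RF.E u u := by
  have hc := RF.const_mem c
  have h0 : RF.E (fun _ => c) (fun _ => c) = 0 := (RF.zero_iff _ hc).2 ⟨c, fun _ => rfl⟩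
  have key : RF.E u (fun _ => c) = 0 := by
    by_contra hne
    have h1 := RF.expand hu hc (-(RF.E u u + 1) / (2 * RF.E u (fun _ => c)))
    have h2 := RF.nonneg _ (RF.add_mem u hu _
      (RF.smul_mem (-(RF.E u u + 1) / (2 * RF.E u (fun _ => c))) _ hc))
    rw [h1, h0] at h2
    have h3 : 2 * (-(RF.E u u + 1) / (2 * RF.E u (fun _ => c))) * RF.E u (fun _ => c)
      = -(RF.E u u + 1) := by field_simp
    rw [h3] at h2
    linarith
  have h := RF.expand hu hc 1
  rw [one_smul, key, h0] at h
  linarith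

theorem split {V : Type*} (RF : ResistanceForm V) {f : V → ℝ} (hf : f ∈ RF.F)
    (h1 : ∀ x, f x ≤ 1) :
    (fun x => max (f x) 0) ∈ RF.F ∧ (fun x => max (f x) 0 - f x) ∈ RF.F ∧
    RF.E (fun x => max (f x) 0) (fun x => max (f x) 0) +
      RF.E (fun x => max (f x) 0 - f x) (fun x => max (f x) 0 - f x) ≤ RF.E f f := by
  obtain ⟨p, hp⟩ : ∃ p : V → ℝ, p = fun x => max (f x) 0 := ⟨_, rfl⟩
  obtain ⟨n, hn⟩ : ∃ n : V → ℝ, n = fun x => max (f x) 0 - f x := ⟨_, rfl⟩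
  rw [← hp, ← hn]
  have hpF : p ∈ RF.F := by
    have := (RF.markov f hf).1
    convert this using 1
    rw [hp]; funext x
    exact (min_eq_left (max_le (h1 x) zero_le_one)).symm
  have hnF : n ∈ RF.F := by
    have := RF.add_mem p hpF _ (RF.smul_mem (-1) f hf)
    convert this using 1
    rw [hn, hp]; funext x
    simp [sub_eq_add_neg]
  refine ⟨hpF, hnF, ?_⟩
  have hs : ∀ s : ℝ, 0 < s → RF.E p p ≤ RF.E (p + (-s) • n) (p + (-s) • n) := by
    intro s hs
    have hm := (RF.markov _ (RF.add_mem p hpF _ (RF.smul_mem (-s) n hnF))).2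
    have : (fun x => min (max ((p + (-s) • n) x) 0) 1) = p := by
      funext x
      simp only [hp, hn, Pi.add_apply, Pi.smul_apply, smul_eq_mul]
      have := h1 x
      rcases le_total (f x) 0 with h | h
      · rw [max_eq_right h]
        have : 0 + -s * (0 - f x) ≤ 0 := by nlinarith
        rw [max_eq_right this]; simp
      · rw [max_eq_left h]
        simp [h, this]
    rwa [this] at hm
  have hneg : RF.E p n ≤ 0 := by
    by_contra hpos
    push Not at hpos
    have hn0 := RF.nonneg n hnF
    have hspos : 0 < RF.E p n / (RF.E n n + 1) := by positivity
    have h2 := hs _ hspos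
    rw [RF.expand hpF hnF] at h2
    set s := RF.E p n / (RF.E n n + 1) with hsdef
    have h3 : s * (RF.E n n + 1) = RF.E p n := by rw [hsdef]; field_simp
    nlinarith [mul_pos hspos hpos, mul_pos hspos hspos]
  have hfe : f = p + (-1 : ℝ) • n := by
    rw [hp, hn]; funext x; simp
  have h4 := RF.expand hpF hnF (-1)
  rw [← hfe] at h4
  linarith

end ResistanceForm

/-- Let `(E, F)` be a resistance form on a countable set `V*`.  Then
the effective resistance
`R(x,y) = sup {(u(x) − u(y))² / E(u,u) : u ∈ F, E(u,u) > 0}` is a metric on `V*`: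
it is nonnegative, vanishes exactly on the diagonal, is symmetric and satisfies the
triangle inequality. -/
theorem effective_resistance_is_metric (V : Type*) [Countable V]
    (RF : ResistanceForm V) (R : V → V → ℝ)
    (hR : ∀ x y : V, R x y =
      sSup {r : ℝ | ∃ u ∈ RF.F, 0 < RF.E u u ∧ r = (u x - u y) ^ 2 / RF.E u u}) :
    (∀ x y : V, 0 ≤ R x y) ∧ (∀ x y : V, R x y = 0 ↔ x = y) ∧
    (∀ x y : V, R x y = R y x) ∧
    (∀ x y z : V, R x z ≤ R x y + R y z) := by
  have hnn : ∀ x y : V, 0 ≤ R x y := by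
    intro x y
    rw [hR]
    apply Real.sSup_nonneg
    rintro r ⟨u, _, h, rfl⟩
    positivity
  have key : ∀ x y : V, ∀ u ∈ RF.F, (u x - u y) ^ 2 ≤ R x y * RF.E u u := by
    intro x y u hu
    rcases (RF.nonneg u hu).eq_or_lt with h | h
    · obtain ⟨c, hc⟩ := (RF.zero_iff u hu).1 h.symm
      rw [← h, hc x, hc y]; simp
    · rw [← div_le_iff₀ h, hR]
      exact le_csSup (RF.resistance_bdd x y) ⟨u, hu, h, rfl⟩
  refine ⟨hnn, ?_, ?_, ?_⟩
  · intro x y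
    constructor
    · intro h
      classical
      by_contra hxy
      obtain ⟨u, hu, hux⟩ := RF.finite_ext {x, y} (fun a => if a = x then 1 else 0)
      have h1 := hux x (by simp)
      have h2 := hux y (by simp)
      have h3 := key x y u hu
      rw [h1, h2, h] at h3
      simp [Ne.symm hxy] at h3
      norm_num at h3
    · rintro rfl
      refine le_antisymm ?_ (hnn x x)
      rw [hR]
      apply Real.sSup_nonpos
      rintro r ⟨u, _, h, rfl⟩
      simp
  · intro x y
    rw [hR, hR]
    congr 1
    ext r
    simp only [Set.mem_ofPred_eq]
    constructor <;> rintro ⟨u, hu, h, rfl⟩ <;> exact ⟨u, hu, h, by ring⟩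
  · intro x y z
    rw [hR x z]
    apply Real.sSup_le _ (add_nonneg (hnn x y) (hnn y z))
    rintro r ⟨u, hu, h, rfl⟩
    rw [div_le_iff₀ h]
    rcases eq_or_ne (u x - u z) 0 with hd | hd
    · rw [hd]
      have := mul_nonneg (add_nonneg (hnn x y) (hnn y z)) h.le
      simpa using this
    obtain ⟨d, hdd⟩ : ∃ d, d = u x - u z := ⟨_, rfl⟩
    rw [← hdd] at hd ⊢
    have hu1 := RF.add_mem u hu _ (RF.const_mem (-u z))
    have hvF := RF.smul_mem d⁻¹ _ hu1
    have hvE : RF.E (d⁻¹ • (u + fun _ => -u z)) (d⁻¹ • (u + fun _ => -u z))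
        = (d⁻¹) ^ 2 * RF.E u u := by
      rw [RF.smul_left _ _ hu1 _ hvF, RF.symm, RF.smul_left _ _ hu1 _ hu1,
        RF.const_energy hu]
      ring
    obtain ⟨hwF, hwE⟩ := RF.markov _ hvF
    rw [hvE] at hwE
    obtain ⟨w, hw⟩ : ∃ w : V → ℝ,
      w = fun x => min (max ((d⁻¹ • (u + fun _ => -u z) : V → ℝ) x) 0) 1 := ⟨_, rfl⟩
    rw [← hw] at hwF hwE
    have hwx : w x = 1 := by
      have : d⁻¹ * (u x + -u z) = 1 := by
        rw [← sub_eq_add_neg, ← hdd]; exact inv_mul_cancel₀ hd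
      simp [hw, this]
    have hwz : w z = 0 := by simp [hw]
    have hw0 : ∀ a, 0 ≤ w a := fun a => by rw [hw]; simp
    have hw1 : ∀ a, w a ≤ 1 := fun a => by rw [hw]; simp
    obtain ⟨t, ht⟩ : ∃ t, t = w y := ⟨_, rfl⟩
    have ht0 : 0 ≤ t := ht ▸ hw0 y
    have ht1 : t ≤ 1 := ht ▸ hw1 y
    have hfF := RF.add_mem w hwF _ (RF.const_mem (-t))
    obtain ⟨hpF, hnF, hE⟩ := RF.split hfF (fun a => by
      have := hw1 a
      simp only [Pi.add_apply]; linarith)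
    rw [RF.const_energy hwF] at hE
    have k1 := key x y _ hpF
    have k2 := key y z _ hnF
    simp only [Pi.add_apply, hwx, hwz, ← ht] at k1 k2
    rw [max_eq_left (by linarith : (0:ℝ) ≤ 1 + -t)] at k1
    rw [max_eq_right (by linarith : 0 + -t ≤ (0:ℝ))] at k2
    simp only [add_neg_cancel, max_self, sub_zero, zero_add, sub_neg_eq_add, zero_sub] at k1 k2
    have hA := RF.nonneg _ hpF
    have hB := RF.nonneg _ hnF
    simp only [Pi.add_apply] at hE hA hB
    generalize RF.E (fun a => max (w a + -t) 0) (fun a => max (w a + -t) 0) = A at *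
    generalize RF.E (fun a => max (w a + -t) 0 - (w a + -t))
      (fun a => max (w a + -t) 0 - (w a + -t)) = B at *
    have ha := hnn x y
    have hb := hnn y z
    generalize R x y = a at *
    generalize R y z = b at *
    have m : (1 + -t) ^ 2 * (-t) ^ 2 ≤ (a * A) * (b * B) :=
      mul_le_mul k1 k2 (by positivity) (by positivity)
    have hc : 2 * (t * (1 - t)) ≤ a * B + b * A := by
      refine (fun h1 h2 => (abs_le_of_sq_le_sq' h1 h2).2 : (2 * (t * (1 - t)))^2 ≤ (a * B + b * A)^2 → 0 ≤ a * B + b * A → _) ?_ (by positivity)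
      nlinarith [sq_nonneg (a * B - b * A)]
    have fin1 : 1 ≤ (a + b) * (A + B) := by nlinarith
    have fin2 : 1 ≤ (a + b) * (d⁻¹ ^ 2 * RF.E u u) :=
      fin1.trans (mul_le_mul_of_nonneg_left (hE.trans hwE) (by positivity))
    have hd2 : 0 < d ^ 2 := by positivity
    calc d ^ 2 = d ^ 2 * 1 := by ring
      _ ≤ d ^ 2 * ((a + b) * (d⁻¹ ^ 2 * RF.E u u)) := mul_le_mul_of_nonneg_left fin2 hd2.le
      _ = (a + b) * RF.E u u := by field_simp
end
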